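/- After Matchday 4, if a team A has at least 10 current points and both ordered matches between A and another team B belong to P (A has already played two matches against B), then A obtained strictly more points than B in their two mutual matches. -/

import Mathlib

/-- Teams are the elements of `Fin 4`. -/
abbrev Team : Type := Fin 4

/-- A complete tournament assigns to each ordered pair `(i, j)` (with `i` at home)
a result `(goals scored by i, goals scored by j)`.  Only values at pairs of
distinct teams are meaningful. -/
abbrev Tournament : Type := Team → Team → ℕ × ℕ

/-- Points obtained in a single match by a team scoring `g` goals and conceding `c`. -/
def matchPts (g c : ℕ) : ℕ := if c < g then 3 else if g = c then 1 else 0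

/-- The set of all 12 ordered matches. -/
def allMatches : Finset (Team × Team) := Finset.univ.filter (fun m => m.1 ≠ m.2)

/-- Points of team `i` summed over the matches in `P` (the played matches). -/
def currentPts (P : Finset (Team × Team)) (T : Tournament) (i : Team) : ℕ :=
  ∑ m ∈ P,
    (if m.1 = i then matchPts (T m.1 m.2).1 (T m.1 m.2).2
     else if m.2 = i then matchPts (T m.1 m.2).2 (T m.1 m.2).1
     else 0)

/-- Total points of team `i` in a complete tournament. -/
def totalPts (T : Tournament) (i : Team) : ℕ := currentPts allMatches T i

/-- Goal difference of team `i` in a complete tournament. -/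
def goalDiff (T : Tournament) (i : Team) : ℤ :=
  ∑ m ∈ allMatches,
    (if m.1 = i then ((T m.1 m.2).1 : ℤ) - ((T m.1 m.2).2 : ℤ)
     else if m.2 = i then ((T m.1 m.2).2 : ℤ) - ((T m.1 m.2).1 : ℤ)
     else 0)

/-- Points obtained by team `i` in its two mutual matches against team `j`. -/
def mutualPts (T : Tournament) (i j : Team) : ℕ :=
  matchPts (T i j).1 (T i j).2 + matchPts (T j i).2 (T j i).1

/-- Goal difference of team `i` in its two mutual matches against team `j`. -/
def mutualGD (T : Tournament) (i j : Team) : ℤ :=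
  (((T i j).1 : ℤ) - ((T i j).2 : ℤ)) + (((T j i).2 : ℤ) - ((T j i).1 : ℤ))

/-- Goal-difference tiebreak: `i` is ranked strictly above `j`. -/
def RankedAboveGD (T : Tournament) (i j : Team) : Prop :=
  totalPts T j < totalPts T i ∨
    (totalPts T i = totalPts T j ∧ goalDiff T j < goalDiff T i)

/-- Head-to-head tiebreak: `i` is ranked strictly above `j`. -/
def RankedAboveH2H (T : Tournament) (i j : Team) : Prop :=
  totalPts T j < totalPts T i ∨
    (totalPts T i = totalPts T j ∧ mutualPts T j i < mutualPts T i j) ∨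
    (totalPts T i = totalPts T j ∧ mutualPts T i j = mutualPts T j i ∧
      mutualGD T j i < mutualGD T i j)

open Classical in
/-- Final position of team `i` under the goal-difference tiebreak. -/
noncomputable def finalPosGD (T : Tournament) (i : Team) : ℕ :=
  1 + (Finset.univ.filter (fun j => RankedAboveGD T j i)).card

open Classical in
/-- Final position of team `i` under the head-to-head tiebreak. -/
noncomputable def finalPosH2H (T : Tournament) (i : Team) : ℕ :=
  1 + (Finset.univ.filter (fun j => RankedAboveH2H T j i)).card

/-- `T'` is a completion of the partial tournament `(P, T)`. -/
def Completes (P : Finset (Team × Team)) (T T' : Tournament) : Prop :=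
  ∀ m ∈ P, T' m.1 m.2 = T m.1 m.2

/-- The set `P` of played matches corresponds to the situation after Matchday 4:
every unordered pair of distinct teams has at least one of its ordered matches
played, and exactly two unordered pairs — which are disjoint, forming a perfect
matching of the four teams — have both of their ordered matches played. -/
def AfterMD4 (P : Finset (Team × Team)) : Prop :=
  (∀ m ∈ P, m.1 ≠ m.2) ∧
  (∀ i j : Team, i ≠ j → (i, j) ∈ P ∨ (j, i) ∈ P) ∧
  ∃ a b c d : Team,
    ({a, b, c, d} : Finset Team) = Finset.univ ∧
    (a, b) ∈ P ∧ (b, a) ∈ P ∧ (c, d) ∈ P ∧ (d, c) ∈ P ∧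
    ∀ i j : Team, (i, j) ∈ P → (j, i) ∈ P →
      ({i, j} : Finset Team) = {a, b} ∨ ({i, j} : Finset Team) = {c, d}

theorem matchPts_le_three (g c : ℕ) : matchPts g c ≤ 3 := by
  unfold matchPts
  split_ifs <;> omega

theorem mutualPts_lt_of_four_le (T : Tournament) (i j : Team) (h : 4 ≤ mutualPts T i j) :
    mutualPts T j i < mutualPts T i j := by
  unfold mutualPts matchPts at *
  split_ifs at * <;> omega

theorem ne_of_insert_eq_univ : ∀ a b c d : Team, ({a, b, c, d} : Finset Team) = Finset.univ →
    a ≠ c ∧ a ≠ d ∧ b ≠ c ∧ b ≠ d := by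
  decide

/-- After Matchday 4 a team has played both matches against at most one opponent. -/
theorem AfterMD4.doubled_opponent_unique {P : Finset (Team × Team)} (hP : AfterMD4 P)
    {A B C : Team} (hB : (A, B) ∈ P) (hB' : (B, A) ∈ P) (hC : (A, C) ∈ P) (hC' : (C, A) ∈ P) :
    C = B := by
  obtain ⟨hne, -, a, b, c, d, huniv, -, -, -, -, hdbl⟩ := hP
  obtain ⟨hac, had, hbc, hbd⟩ := ne_of_insert_eq_univ a b c d huniv
  have hAB : A ≠ B := hne _ hB
  have hAC : A ≠ C := hne _ hC
  have key := hdbl A B hB hB'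
  have key' := hdbl A C hC hC'
  simp only [Finset.ext_iff, Finset.mem_insert, Finset.mem_singleton] at key key'
  clear hne hdbl huniv
  rcases key with key | key <;> rcases key' with key' | key' <;>
  · have := key A
    have := key B
    have := key' A
    have := key' C
    clear key key'
    grind

/-- After Matchday 4 a team has played at most two matches against opponents
other than its doubled opponent. -/
theorem AfterMD4.card_other_matches_le {P : Finset (Team × Team)} (hP : AfterMD4 P)
    {A B : Team} (hAB : A ≠ B) (hB : (A, B) ∈ P) (hB' : (B, A) ∈ P) :
    ((P \ {(A, B), (B, A)}).filter (fun m => m.1 = A ∨ m.2 = A)).card ≤ 2 := by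
  have hcard : (Finset.univ \ {A, B} : Finset Team).card = 2 := by
    rw [Finset.card_sdiff_of_subset (Finset.subset_univ _), Finset.card_pair hAB]
    rfl
  rw [← hcard]
  have hne := hP.1
  have huniq := fun C => hP.doubled_opponent_unique (C := C) hB hB'
  refine Finset.card_le_card_of_injOn (fun m => if m.1 = A then m.2 else m.1) ?_ ?_
  · rintro ⟨i, j⟩ hm
    have := hne (i, j)
    simp at hm this ⊢
    grind
  · rintro ⟨i, j⟩ hm ⟨k, l⟩ hm' heq
    simp at hm hm' heq ⊢
    grind

/-- After Matchday 4, a team `A` with at least 10 current points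
which has already played both matches against `B` obtained strictly more points
than `B` in their two mutual matches. -/
theorem tenPoints_beats_doubled_opponent_headToHead
    (P : Finset (Team × Team)) (T : Tournament) (hP : AfterMD4 P)
    (A B : Team) (hAB : A ≠ B)
    (hpts : 10 ≤ currentPts P T A)
    (h₁ : (A, B) ∈ P) (h₂ : (B, A) ∈ P) :
    mutualPts T B A < mutualPts T A B := by
  apply mutualPts_lt_of_four_le
  have hsub : ({(A, B), (B, A)} : Finset (Team × Team)) ⊆ P := by
    simp [Finset.insert_subset_iff, h₁, h₂]
  have hpair : ((A, B) : Team × Team) ≠ (B, A) := by simp [hAB]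
  have hcard := hP.card_other_matches_le hAB h₁ h₂
  rw [currentPts, ← Finset.sum_sdiff hsub, Finset.sum_pair hpair] at hpts
  have hrest : ∑ m ∈ P \ {(A, B), (B, A)},
      (if m.1 = A then matchPts (T m.1 m.2).1 (T m.1 m.2).2
       else if m.2 = A then matchPts (T m.1 m.2).2 (T m.1 m.2).1
       else 0) ≤
      ((P \ {(A, B), (B, A)}).filter (fun m => m.1 = A ∨ m.2 = A)).card * 3 := by
    rw [Finset.card_filter, Finset.sum_mul]
    refine Finset.sum_le_sum fun m _ => ?_
    have := matchPts_le_three (T m.1 m.2).1 (T m.1 m.2).2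
    have := matchPts_le_three (T m.1 m.2).2 (T m.1 m.2).1
    grind
  simp only [if_true, if_neg hAB.symm] at hpts
  unfold mutualPts
  omega
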